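/- Let F be a positive integer and let n_1 < n_2 < ... < n_p < F be positive integers with d = gcd{n_1,...,n_p} not dividing F. For each i ∈ {1,...,p} let d_i = gcd{n_1,...,n_i}; for each j ∈ {1,...,p−1} let k_j = max{k ∈ ℕ : n_j + k·d_j < n_{j+1}}, and let k_p = max{k ∈ ℕ : n_p + k·d_p < F}. Then Sat(F)[{n_1,...,n_p}] = {0} ∪ {n_j + t·d_j : j ∈ {1,...,p}, t ∈ {0,1,...,k_j}} ∪ {x ∈ ℕ : x ≥ F+1}. -/

import Mathlib

/-- A numerical semigroup: subset of ℕ containing 0, closed under addition,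
with finite complement. -/
def IsNumericalSemigroup (S : Set ℕ) : Prop :=
  0 ∈ S ∧ (∀ a ∈ S, ∀ b ∈ S, a + b ∈ S) ∧ Sᶜ.Finite

/-- `dOf S s = gcd {x ∈ S : x ≤ s}`. -/
noncomputable def dOf (S : Set ℕ) (s : ℕ) : ℕ :=
  letI := Classical.decPred (· ∈ S)
  ((Finset.range (s + 1)).filter (· ∈ S)).gcd id

/-- A saturated numerical semigroup. -/
def IsSaturatedNS (S : Set ℕ) : Prop :=
  IsNumericalSemigroup S ∧ ∀ s ∈ S, s ≠ 0 → s + dOf S s ∈ S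

/-- `Sat F`: saturated numerical semigroups with Frobenius number `F`. -/
def SatF (F : ℕ) : Set (Set ℕ) :=
  {S | IsSaturatedNS S ∧ F ∉ S ∧ ∀ x, x ∉ S → x ≤ F}

/-- Multiplicity: least nonzero element. -/
noncomputable def multOf (S : Set ℕ) : ℕ := sInf {x | x ∈ S ∧ x ≠ 0}

/-- Pseudo-Frobenius numbers. -/
def PFset (S : Set ℕ) : Set ℕ := {z | z ∉ S ∧ ∀ s ∈ S, s ≠ 0 → z + s ∈ S}

/-- Special gaps. -/
def SGset (S : Set ℕ) : Set ℕ := {x | x ∈ PFset S ∧ 2 * x ∈ S}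

/-- `TSet a b = ⟨a⟩ ∪ {x : x ≥ b}`. -/
def TSet (a b : ℕ) : Set ℕ := {x | a ∣ x} ∪ {x | b ≤ x}

/-- A `Sat(F)`-set. -/
def SatFSet (F : ℕ) (X : Set ℕ) : Prop :=
  X ∩ ({0} ∪ {x | F + 1 ≤ x}) = ∅ ∧ ∃ S ∈ SatF F, X ⊆ S

/-- `Sat(F)[X]`: intersection of all elements of `Sat F` containing `X`. -/
def SatClosure (F : ℕ) (X : Set ℕ) : Set ℕ := ⋂₀ {S | S ∈ SatF F ∧ X ⊆ S}

/-- `X` is a minimal `Sat(F)`-system of generators of `S`. -/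
def IsMinSatGen (F : ℕ) (X S : Set ℕ) : Prop :=
  SatFSet F X ∧ SatClosure F X = S ∧ ∀ Y : Set ℕ, Y ⊂ X → SatClosure F Y ≠ S

/-- The `Sat(F)`-rank of `S`: minimal cardinality of a `Sat(F)`-set `X`
with `Sat(F)[X] = S`. -/
noncomputable def SatRank (F : ℕ) (S : Set ℕ) : ℕ :=
  sInf {k | ∃ X : Set ℕ, SatFSet F X ∧ SatClosure F X = S ∧ X.ncard = k}

/-- `dOf S s` divides every element of `S` that is at most `s`. -/
theorem dOf_dvd {S : Set ℕ} {s x : ℕ} (hx : x ∈ S) (hxs : x ≤ s) : dOf S s ∣ x := by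
  unfold dOf
  exact Finset.gcd_dvd (f := id) (by simp [hx]; omega)

/-- A common divisor of the elements of `S` up to `s` divides `dOf S s`. -/
theorem dvd_dOf {S : Set ℕ} {s c : ℕ} (h : ∀ x ∈ S, x ≤ s → c ∣ x) : c ∣ dOf S s := by
  unfold dOf
  refine Finset.dvd_gcd fun x hx => ?_
  simp only [Finset.mem_filter, Finset.mem_range] at hx
  exact h x hx.2 (by omega)

/-- `dOf S` is antitone for divisibility. -/
theorem dOf_dvd_dOf {S : Set ℕ} {s t : ℕ} (hst : s ≤ t) : dOf S t ∣ dOf S s :=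
  dvd_dOf fun _ hx hxs => dOf_dvd hx (hxs.trans hst)

/-- In a saturated numerical semigroup, adding any multiple of `dOf S s` to a nonzero
element `s` stays in the semigroup. -/
theorem IsSaturatedNS.add_mem_of_dvd {S : Set ℕ} (hS : IsSaturatedNS S) {s e : ℕ}
    (hs : s ∈ S) (hs0 : s ≠ 0) (he : dOf S s ∣ e) : s + e ∈ S := by
  induction e using Nat.strong_induction_on generalizing s with
  | _ e ih =>
    rcases Nat.eq_zero_or_pos e with rfl | hpos
    · simpa using hs
    · have hd0 : 0 < dOf S s := Nat.pos_of_dvd_of_pos (dOf_dvd hs le_rfl) (by omega)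
      have hle : dOf S s ≤ e := Nat.le_of_dvd hpos he
      have key := ih (e - dOf S s) (by omega) (hS.2 s hs hs0) (by omega)
        ((dOf_dvd_dOf (Nat.le_add_right _ _)).trans (Nat.dvd_sub he dvd_rfl))
      rwa [add_assoc, Nat.add_sub_cancel' hle] at key

/-- The numbers that are zero, exceed `F`, or are a multiple of some `d j` at least `n j`. -/
def chainSet (F p : ℕ) (n d : ℕ → ℕ) : Set ℕ :=
  {x | x = 0 ∨ F < x ∨ ∃ j, 1 ≤ j ∧ j ≤ p ∧ n j ≤ x ∧ d j ∣ x}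

/-- Among the indices in `[1, p]` whose value of `n` is at most `x`, there is a greatest one. -/
theorem exists_greatest_index {p x i : ℕ} {n : ℕ → ℕ} (hi : 1 ≤ i) (hip : i ≤ p)
    (hx : n i ≤ x) :
    ∃ j, 1 ≤ j ∧ j ≤ p ∧ n j ≤ x ∧ ∀ l, 1 ≤ l → l ≤ p → n l ≤ x → l ≤ j := by
  have hspec := Nat.findGreatest_spec (P := fun l => 1 ≤ l ∧ n l ≤ x) hip ⟨hi, hx⟩
  exact ⟨_, hspec.1, Nat.findGreatest_le p, hspec.2,
    fun l hl hlp hlx => Nat.le_findGreatest hlp ⟨hl, hlx⟩⟩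

/-- `chainSet` is a saturated numerical semigroup with Frobenius number `F`. -/
theorem chainSet_mem_SatF {F p : ℕ} {n d : ℕ → ℕ} (hF : 0 < F)
    (hdvd : ∀ i j, 1 ≤ i → i ≤ j → j ≤ p → d j ∣ d i) (hdF : ¬ d p ∣ F) :
    chainSet F p n d ∈ SatF F := by
  refine ⟨⟨⟨Or.inl rfl, ?_, ?_⟩, ?_⟩, ?_, ?_⟩
  · rintro a (rfl | ha | ⟨i, hi, hip, hia, hda⟩) b hb
    · simpa using hb
    · exact Or.inr (Or.inl (by omega))
    · rcases hb with rfl | hb | ⟨j, hj, hjp, hjb, hdb⟩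
      · exact Or.inr (Or.inr ⟨i, hi, hip, hia, hda⟩)
      · exact Or.inr (Or.inl (by omega))
      · refine Or.inr (Or.inr ?_)
        rcases le_total i j with h | h
        · exact ⟨j, hj, hjp, by omega, ((hdvd i j hi h hjp).trans hda).add hdb⟩
        · exact ⟨i, hi, hip, by omega, hda.add ((hdvd j i hj h hip).trans hdb)⟩
  · refine (Set.finite_Iic F).subset fun x hx => ?_
    by_contra h
    exact hx (Or.inr (Or.inl (by simpa using h)))
  · rintro s hs hs0
    by_cases hsF : F < s
    · exact Or.inr (Or.inl (by omega))
    · obtain h | h | ⟨i, hi, hip, his, hds⟩ := id hs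
      · exact absurd h hs0
      · exact absurd h hsF
      · obtain ⟨j, hj, hjp, hjs, hmax⟩ := exists_greatest_index hi hip his
        refine Or.inr (Or.inr ⟨j, hj, hjp, by omega, ?_⟩)
        refine ((hdvd i j hi (hmax i hi hip his) hjp).trans hds).add (dvd_dOf ?_)
        rintro x (rfl | hx | ⟨l, hl, hlp, hlx, hdx⟩) hxs
        · exact dvd_zero _
        · omega
        · exact (hdvd l j hl (hmax l hl hlp (hlx.trans hxs)) hjp).trans hdx
  · rintro (h | h | ⟨j, hj, hjp, -, hdj⟩)
    · omega
    · omega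
    · exact hdF ((hdvd j p hj hjp le_rfl).trans hdj)
  · intro x hx
    by_contra h
    exact hx (Or.inr (Or.inl (by omega)))

/-- explicit description of `Sat(F)[{n₁,…,n_p}]`. -/
theorem SatClosure_explicit (F p : ℕ) (hF : 0 < F) (hp : 0 < p)
    (n : ℕ → ℕ)
    (hpos : ∀ i, 1 ≤ i → i ≤ p → 0 < n i)
    (hmono : ∀ i, 1 ≤ i → i < p → n i < n (i + 1))
    (hnpF : n p < F)
    (d : ℕ → ℕ)
    (hd : ∀ i, 1 ≤ i → i ≤ p → d i = (Finset.Icc 1 i).gcd n)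
    (hdF : ¬ d p ∣ F)
    (k : ℕ → ℕ)
    (hkj : ∀ j, 1 ≤ j → j < p →
      n j + k j * d j < n (j + 1) ∧
        ∀ k' : ℕ, n j + k' * d j < n (j + 1) → k' ≤ k j)
    (hkp : n p + k p * d p < F ∧ ∀ k' : ℕ, n p + k' * d p < F → k' ≤ k p) :
    SatClosure F {x | ∃ i, 1 ≤ i ∧ i ≤ p ∧ x = n i} =
      {0} ∪ {x | ∃ j, 1 ≤ j ∧ j ≤ p ∧ ∃ t, t ≤ k j ∧ x = n j + t * d j} ∪
        {x | F + 1 ≤ x} := by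
  have hdvd : ∀ i j, 1 ≤ i → i ≤ j → j ≤ p → d j ∣ d i := fun i j hi hij hjp => by
    rw [hd i hi (hij.trans hjp), hd j (hi.trans hij) hjp]
    exact Finset.gcd_mono (Finset.Icc_subset_Icc le_rfl hij)
  have hmono' : ∀ i j, 1 ≤ i → i ≤ j → j ≤ p → n i ≤ n j := fun i j hi hij => by
    induction j, hij using Nat.le_induction with
    | base => exact fun _ => le_rfl
    | succ m him ih => exact fun hm => (ih (by omega)).trans (hmono m (hi.trans him) hm).le
  have hdn : ∀ i, 1 ≤ i → i ≤ p → d i ∣ n i := fun i hi hip => by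
    rw [hd i hi hip]
    exact Finset.gcd_dvd (Finset.mem_Icc.2 ⟨hi, le_rfl⟩)
  have hset : ({0} ∪ {x | ∃ j, 1 ≤ j ∧ j ≤ p ∧ ∃ t, t ≤ k j ∧ x = n j + t * d j} ∪
      {x | F + 1 ≤ x} : Set ℕ) = chainSet F p n d := by
    ext x
    constructor
    · rintro ((h | ⟨j, hj, hjp, t, -, rfl⟩) | h)
      · exact Or.inl h
      · exact Or.inr (Or.inr ⟨j, hj, hjp, Nat.le_add_right _ _,
          (hdn j hj hjp).add (dvd_mul_left _ _)⟩)
      · exact Or.inr (Or.inl h)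
    · rintro (h | h | ⟨i, hi, hip, hix, hdx⟩)
      · exact Or.inl (Or.inl h)
      · exact Or.inr h
      · by_cases hxF : F < x
        · exact Or.inr hxF
        have hne : x ≠ F := by
          rintro rfl
          exact hdF ((hdvd i p hi hip le_rfl).trans hdx)
        obtain ⟨j, hj, hjp, hjx, hmax⟩ := exists_greatest_index hi hip hix
        have hdj : d j ∣ x - n j :=
          Nat.dvd_sub ((hdvd i j hi (hmax i hi hip hix) hjp).trans hdx) (hdn j hj hjp)
        obtain ⟨t, ht⟩ := hdj
        have hxt : x = n j + t * d j := by
          rw [mul_comm] at ht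
          omega
        refine Or.inl (Or.inr ⟨j, hj, hjp, t, ?_, hxt⟩)
        rcases hjp.eq_or_lt with rfl | hlt
        · exact hkp.2 t (by omega)
        · refine (hkj j hj hlt).2 t ?_
          rw [← hxt]
          by_contra hle
          have := hmax (j + 1) (by omega) hlt (by omega)
          omega
  rw [hset]
  apply Set.Subset.antisymm
  · refine Set.sInter_subset_of_mem ⟨chainSet_mem_SatF hF hdvd hdF, ?_⟩
    rintro x ⟨i, hi, hip, rfl⟩
    exact Or.inr (Or.inr ⟨i, hi, hip, le_rfl, hdn i hi hip⟩)
  · rintro x hx S ⟨⟨hS, -, hSF⟩, hXS⟩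
    obtain rfl | h | ⟨j, hj, hjp, hjx, hdx⟩ := hx
    · exact hS.1.1
    · by_contra hxS
      exact absurd (hSF x hxS) (by omega)
    · have hdj : dOf S (n j) ∣ d j := by
        rw [hd j hj hjp]
        refine Finset.dvd_gcd fun i hi => ?_
        obtain ⟨hi, hij⟩ := Finset.mem_Icc.1 hi
        exact dOf_dvd (hXS ⟨i, hi, hij.trans hjp, rfl⟩) (hmono' i j hi hij hjp)
      have key := hS.add_mem_of_dvd (hXS ⟨j, hj, hjp, rfl⟩) (hpos j hj hjp).ne'
        (hdj.trans (Nat.dvd_sub hdx (hdn j hj hjp)))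
      rwa [Nat.add_sub_cancel' hjx] at key
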